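/- arXiv:2509.06388 — 3 statements merged into one kernel-verified Lean document; each statement's English description precedes it below -/
import Mathlib

section
/- Let n ≥ 1 and let A : Matrix (Fin n) (Fin n) ℝ be a positive reciprocal matrix, i.e., A i j > 0 and A j i = 1 / A i j for all i, j (hence A i i = 1). Suppose w : Fin n → ℝ has all entries positive and A.mulVec w = λ • w for some real λ. Then λ ≥ n. In particular, the consistency index CI = (λ − n)/(n − 1) is nonnegative. -/
/-- If the entries of a real square array satisfy `2 ≤ x i j + x j i`, their sum is at least the
number of entries. -/
theorem sq_card_le_sum_of_two_le_add_swap {ι : Type*} [Fintype ι] (x : ι → ι → ℝ)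
    (hx : ∀ i j, 2 ≤ x i j + x j i) :
    (Fintype.card ι : ℝ) * Fintype.card ι ≤ ∑ i, ∑ j, x i j := by
  have h : ∑ _i : ι, ∑ _j : ι, (2 : ℝ) ≤ ∑ i, ∑ j, (x i j + x j i) :=
    Finset.sum_le_sum fun i _ => Finset.sum_le_sum fun j _ => hx i j
  simp only [Finset.sum_add_distrib, Finset.sum_const, Finset.card_univ, nsmul_eq_mul] at h
  rw [Finset.sum_comm (f := fun i j => x j i)] at h
  linarith

theorem two_le_add_of_mul_eq_one {x y : ℝ} (hx : 0 < x) (hy : 0 < y) (h : x * y = 1) :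
    2 ≤ x + y := by
  nlinarith [sq_nonneg (x - y)]

theorem reciprocal_matrix_eigenvalue_ge (n : ℕ) (hn : 1 ≤ n)
    (A : Matrix (Fin n) (Fin n) ℝ)
    (hpos : ∀ i j, 0 < A i j) (hrec : ∀ i j, A j i = 1 / A i j)
    (w : Fin n → ℝ) (hw : ∀ i, 0 < w i) (lam : ℝ)
    (heig : A.mulVec w = lam • w) :
    (n : ℝ) ≤ lam ∧ 0 ≤ (lam - n) / ((n : ℝ) - 1) := by
  have hn' : (1 : ℝ) ≤ n := by exact_mod_cast hn
  have hx : ∀ i j, 0 < A i j * w j / w i := fun i j =>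
    div_pos (mul_pos (hpos i j) (hw j)) (hw i)
  have hrow : ∀ i, ∑ j, A i j * w j / w i = lam := fun i => by
    rw [← Finset.sum_div, div_eq_iff (hw i).ne']
    exact congrFun heig i
  have hsum := sq_card_le_sum_of_two_le_add_swap (fun i j => A i j * w j / w i) fun i j => by
    refine two_le_add_of_mul_eq_one (hx i j) (hx j i) ?_
    have := (hpos i j).ne'
    have := (hw i).ne'
    have := (hw j).ne'
    rw [hrec i j]
    field_simp
  simp only [hrow, Finset.sum_const, Finset.card_univ, Fintype.card_fin, nsmul_eq_mul] at hsum
  have hle : (n : ℝ) ≤ lam := le_of_mul_le_mul_left hsum (by linarith)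
  exact ⟨hle, div_nonneg (sub_nonneg.2 hle) (sub_nonneg.2 hn')⟩
end

section
/- Let n ≥ 1 and let A : Matrix (Fin n) (Fin n) ℝ be a positive reciprocal matrix (A i j > 0 and A j i = 1 / A i j for all i, j). Suppose w : Fin n → ℝ has all entries positive and A.mulVec w = (n : ℝ) • w. Then A is perfectly consistent: A i j = w i / w j for all i, j. -/
/-- A matrix of positive reals with reciprocal transpose entries and all row sums equal to the
cardinality of the index type has every entry equal to one. -/
theorem eq_one_of_reciprocal_of_row_sum {ι : Type*} [Fintype ι] (x : ι → ι → ℝ)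
    (hpos : ∀ i j, 0 < x i j) (hrec : ∀ i j, x i j * x j i = 1)
    (hsum : ∀ i, ∑ j, x i j = Fintype.card ι) (i j : ι) : x i j = 1 := by
  have key (i j : ι) : x i j * (x i j + x j i - 2) = (x i j - 1) ^ 2 := by
    linear_combination hrec i j
  have nonneg (i j : ι) : 0 ≤ x i j + x j i - 2 :=
    nonneg_of_mul_nonneg_right (by rw [key]; positivity) (hpos i j)
  have total : ∑ i, ∑ j, (x i j + x j i - 2) = 0 := by
    have hswap : ∑ i, ∑ j, x j i = ∑ i, ∑ j, x i j := Finset.sum_comm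
    simp only [Finset.sum_sub_distrib, Finset.sum_add_distrib, hswap, hsum, Finset.sum_const,
      Finset.card_univ, nsmul_eq_mul]
    ring
  rw [Fintype.sum_eq_zero_iff_of_nonneg fun i => Finset.sum_nonneg fun j _ => nonneg i j] at total
  have row := congrFun total i
  have term := (Finset.sum_eq_zero_iff_of_nonneg fun j _ => nonneg i j).1 row j (Finset.mem_univ j)
  have sq := key i j
  rw [term, mul_zero] at sq
  exact sub_eq_zero.1 (pow_eq_zero_iff two_ne_zero |>.1 sq.symm)

theorem eigenvalue_n_implies_consistent (n : ℕ) (hn : 1 ≤ n)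
    (A : Matrix (Fin n) (Fin n) ℝ)
    (hpos : ∀ i j, 0 < A i j) (hrec : ∀ i j, A j i = 1 / A i j)
    (w : Fin n → ℝ) (hw : ∀ i, 0 < w i)
    (heig : A.mulVec w = (n : ℝ) • w) :
    ∀ i j, A i j = w i / w j := by
  intro i j
  have h := eq_one_of_reciprocal_of_row_sum (fun i j => A i j * w j / w i)
    (fun i j => div_pos (mul_pos (hpos i j) (hw j)) (hw i))
    (fun i j => by
      have hA := (hpos i j).ne'
      have hi := (hw i).ne'
      have hj := (hw j).ne'
      simp only [hrec i j]
      field_simp)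
    (fun i => by
      have hrow : ∑ j, A i j * w j = n * w i := congrFun heig i
      rw [← Finset.sum_div, hrow, Fintype.card_fin, mul_div_cancel_right₀ _ (hw i).ne'])
    i j
  rw [eq_div_iff (hw j).ne']
  exact (div_eq_one_iff_eq (hw i).ne').1 h
end

section
/- Let m ≥ 2, let S⁻ : Fin m → ℝ be positive (the minimization sums of the m alternatives), fix an index i and a real S⁺. Define the COPRAS score of alternative i as a function of its own minimization sum s > 0 (with the other alternatives' values S⁻ k, k ≠ i, held fixed): P(s) = S⁺ + (s + ∑_{k ≠ i} S⁻ k) / (s * (1/s + ∑_{k ≠ i} 1 / S⁻ k)). Then P is antitone in s on (0, ∞): decreasing alternative i's minimization sum never decreases its COPRAS performance score. -/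
/-- The map `s ↦ (s + c) / (1 + s * d)` is antitone on `(0, ∞)` when `1 ≤ c * d` and `0 ≤ d`. -/
theorem antitoneOn_add_div_one_add_mul {c d : ℝ} (hd : 0 ≤ d) (hcd : 1 ≤ c * d) :
    AntitoneOn (fun s : ℝ => (s + c) / (1 + s * d)) (Set.Ioi 0) := by
  intro a ha b hb hab
  have ha' : 0 < a := ha
  have hb' : 0 < b := hb
  change (b + c) / (1 + b * d) ≤ (a + c) / (1 + a * d)
  rw [div_le_div_iff₀ (by positivity) (by positivity)]
  nlinarith [mul_nonneg (sub_nonneg.2 hab) (sub_nonneg.2 hcd)]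

/-- The sum of positive reals times the sum of their reciprocals is at least one. -/
theorem one_le_sum_mul_sum_one_div {ι : Type*} {t : Finset ι} (ht : t.Nonempty) {f : ι → ℝ}
    (hf : ∀ k, 0 < f k) : 1 ≤ (∑ k ∈ t, f k) * ∑ k ∈ t, 1 / f k := by
  obtain ⟨k, hk⟩ := ht
  calc (1 : ℝ) = f k * (1 / f k) := (mul_one_div_cancel (hf k).ne').symm
    _ ≤ _ := mul_le_mul
      (Finset.single_le_sum (fun j _ => (hf j).le) hk)
      (Finset.single_le_sum (f := fun j => 1 / f j) (fun j _ => (one_div_pos.2 (hf j)).le) hk)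
      (one_div_pos.2 (hf k)).le
      (Finset.sum_nonneg fun j _ => (hf j).le)

theorem copras_score_antitone (m : ℕ) (hm : 2 ≤ m)
    (Sminus : Fin m → ℝ) (hS : ∀ k, 0 < Sminus k) (i : Fin m) (Splus : ℝ) :
    AntitoneOn
      (fun s : ℝ =>
        Splus +
          (s + ∑ k ∈ Finset.univ.erase i, Sminus k) /
            (s * (1 / s + ∑ k ∈ Finset.univ.erase i, 1 / Sminus k)))
      (Set.Ioi (0 : ℝ)) := by
  have hne : (Finset.univ.erase i).Nonempty := by
    rw [← Finset.card_pos, Finset.card_erase_of_mem (Finset.mem_univ i), Finset.card_fin]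
    omega
  have hd : 0 ≤ ∑ k ∈ Finset.univ.erase i, 1 / Sminus k :=
    Finset.sum_nonneg fun k _ => (one_div_pos.2 (hS k)).le
  have hanti := antitoneOn_add_div_one_add_mul hd (one_le_sum_mul_sum_one_div hne hS)
  intro a ha b hb hab
  have key := hanti ha hb hab
  have ha' : a ≠ 0 := ne_of_gt ha
  have hb' : b ≠ 0 := ne_of_gt hb
  simp only [mul_add, mul_one_div_cancel ha', mul_one_div_cancel hb']
  exact add_le_add_right key Splus
end
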